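/- arXiv:1204.0187 — 5 statements merged into one kernel-verified Lean document; each statement's English description precedes it below -/
import Mathlib

section
/- For every integer r ≥ 1 there exists a unique sequence of polynomials (c_i^{(r)}(q))_{i=0}^∞ in the variable q with nonnegative integer coefficients such that for every integer n ≥ 0 one has ∑_{k=0}^n q^{r·C(n−k,2)+(1−r)·C(n,2)} · [n choose k]_q^r · [n+k choose k]_q^r = ∑_{i=0}^n q^{C(n−i,2)+(1−r)·C(i,2)} · [n choose i]_q · [n+i choose i]_q · c_i^{(r)}(q), where C(m,2) denotes the binomial coefficient m(m−1)/2. -/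
open Polynomial LaurentPolynomial Finset

/-- The Gaussian (q-)binomial coefficient `[n choose k]_q` as a polynomial in `q`,
defined by the q-Pascal recursion; it equals `(q)_n / ((q)_k (q)_{n-k})` for `0 ≤ k ≤ n`
and vanishes for `k > n`. -/
noncomputable def qbinom : ℕ → ℕ → Polynomial ℤ
  | _, 0 => 1
  | 0, _ + 1 => 0
  | n + 1, k + 1 => qbinom n k + Polynomial.X ^ (k + 1) * qbinom n (k + 1)

/-- `[n choose k]_q` viewed as a Laurent polynomial. -/
noncomputable def qb (n k : ℕ) : LaurentPolynomial ℤ := (qbinom n k).toLaurent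

/-! ### Gaussian binomial coefficients -/

@[simp] lemma qbinom_zero_right (n : ℕ) : qbinom n 0 = 1 := by
  cases n <;> rfl

lemma qbinom_succ_succ (n k : ℕ) :
    qbinom (n + 1) (k + 1) = qbinom n k + Polynomial.X ^ (k + 1) * qbinom n (k + 1) := rfl

lemma qbinom_eq_zero_of_lt {n k : ℕ} (h : n < k) : qbinom n k = 0 := by
  induction n generalizing k with
  | zero => cases k with
    | zero => omega
    | succ k => rfl
  | succ n ih => cases k with
    | zero => omega
    | succ k => rw [qbinom_succ_succ, ih (by omega), ih (by omega)]; simp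

lemma qbinom_coeff_zero {n k : ℕ} (h : k ≤ n) : (qbinom n k).coeff 0 = 1 := by
  induction n generalizing k with
  | zero => obtain rfl : k = 0 := by omega
            simp
  | succ n ih => cases k with
    | zero => simp
    | succ k => simp [qbinom_succ_succ, ih (show k ≤ n by omega), Polynomial.mul_coeff_zero]

/-- A polynomial all of whose coefficients are nonnegative. -/
def NonnegCoeffs (p : Polynomial ℤ) : Prop := ∀ m, 0 ≤ p.coeff m

namespace NonnegCoeffs

lemma zero : NonnegCoeffs 0 := fun m => by simp

lemma X_pow (n : ℕ) : NonnegCoeffs (Polynomial.X ^ n) := fun m => by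
  rw [Polynomial.coeff_X_pow]; split_ifs <;> simp

lemma one : NonnegCoeffs 1 := by simpa using X_pow 0

lemma add {p q : Polynomial ℤ} (hp : NonnegCoeffs p) (hq : NonnegCoeffs q) :
    NonnegCoeffs (p + q) := fun m => by
  rw [Polynomial.coeff_add]; exact add_nonneg (hp m) (hq m)

lemma mul {p q : Polynomial ℤ} (hp : NonnegCoeffs p) (hq : NonnegCoeffs q) :
    NonnegCoeffs (p * q) := fun m => by
  rw [Polynomial.coeff_mul]; exact Finset.sum_nonneg fun x _ => mul_nonneg (hp _) (hq _)

lemma sum {s : Finset ℕ} {f : ℕ → Polynomial ℤ} (hf : ∀ i, NonnegCoeffs (f i)) :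
    NonnegCoeffs (∑ i ∈ s, f i) := fun m => by
  rw [Polynomial.finsetSum_coeff]; exact Finset.sum_nonneg fun x _ => hf x m

end NonnegCoeffs

lemma qbinom_nonnegCoeffs (n k : ℕ) : NonnegCoeffs (qbinom n k) := by
  induction n generalizing k with
  | zero => cases k with
    | zero => exact .one
    | succ k => exact .zero
  | succ n ih => cases k with
    | zero => exact .one
    | succ k => exact (ih k).add ((NonnegCoeffs.X_pow _).mul (ih _))

@[simp] lemma qb_zero_right (n : ℕ) : qb n 0 = 1 := by simp [qb]

lemma qb_eq_zero_of_lt {n k : ℕ} (h : n < k) : qb n k = 0 := by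
  simp [qb, qbinom_eq_zero_of_lt h]

@[simp] lemma qbinom_self (n : ℕ) : qbinom n n = 1 := by
  induction n with
  | zero => rfl
  | succ n ih => simp [qbinom_succ_succ, ih, qbinom_eq_zero_of_lt]

@[simp] lemma qb_self (n : ℕ) : qb n n = 1 := by simp [qb]

lemma qb_ne_zero {n k : ℕ} (h : k ≤ n) : qb n k ≠ 0 := by
  rw [qb, Polynomial.toLaurent_ne_zero]
  intro h0
  simpa [h0] using qbinom_coeff_zero h

lemma qb_succ_succ (n k : ℕ) : qb (n + 1) (k + 1) = qb n k + T (k + 1) * qb n (k + 1) := by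
  simp [qb, qbinom_succ_succ, Polynomial.toLaurent_X_pow]

lemma one_sub_T_mul_qb_succ_right (n k : ℕ) :
    (1 - T (k + 1)) * qb n (k + 1) = (1 - T (n - k)) * qb n k := by
  induction n generalizing k with
  | zero => cases k with
    | zero => simp [qb_eq_zero_of_lt]
    | succ k => simp [qb_eq_zero_of_lt]
  | succ n ih => cases k with
    | zero =>
      have h := ih 0
      have e : (T (n + 1) : LaurentPolynomial ℤ) = T 1 * T n := by rw [← T_add, add_comm]
      rw [qb_succ_succ]
      push_cast
      simp only [zero_add, sub_zero, qb_zero_right, e, CharP.cast_eq_zero] at h ⊢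
      linear_combination T 1 * h
    | succ k =>
      have h1 := ih k
      have h2 := ih (k + 1)
      rw [qb_succ_succ n k, qb_succ_succ n (k + 1)]
      push_cast at h1 h2 ⊢
      have e : ((n : ℤ) + 1 - (k + 1)) = n - k := by ring
      have e1 : (T (k + 1 + 1) : LaurentPolynomial ℤ) * T (n - (k + 1)) =
        T (k + 1) * T (n - k) := by rw [← T_add, ← T_add]; congr 1; ring
      rw [e]
      linear_combination T (k + 1 + 1) * h2 + h1 - qb n (k + 1) * e1

lemma one_sub_T_mul_qb_succ_left (n k : ℕ) :
    (1 - T (n + 1)) * qb n k = (1 - T (n + 1 - k)) * qb (n + 1) k := by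
  cases k with
  | zero => simp
  | succ k =>
    have h1 := one_sub_T_mul_qb_succ_right n k
    rw [qb_succ_succ]
    push_cast
    have e : ((n : ℤ) + 1 - (k + 1)) = n - k := by ring
    have e1 : (T (n + 1) : LaurentPolynomial ℤ) = T (k + 1) * T (n - k) := by
      rw [← T_add]; congr 1; ring
    rw [e, e1]
    linear_combination h1

lemma one_sub_T_ne_zero (j : ℕ) : (1 - T (j + 1) : LaurentPolynomial ℤ) ≠ 0 := by
  have h : (1 - T (j + 1) : LaurentPolynomial ℤ) =
      Polynomial.toLaurent (1 - Polynomial.X ^ (j + 1)) := by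
    simp [Polynomial.toLaurent_X_pow]
  rw [h, Polynomial.toLaurent_ne_zero]
  intro h0
  simpa using congrArg (Polynomial.eval 0) h0

/-! ### Triangular numbers on the integers -/

/-- The polynomial `z(z-1)/2` on the integers. -/
def triangle (z : ℤ) : ℤ := z * (z - 1) / 2

lemma two_mul_triangle (z : ℤ) : 2 * triangle z = z * (z - 1) :=
  Int.mul_ediv_cancel' (Int.even_mul_pred_self z).two_dvd

lemma triangle_natCast (n : ℕ) : triangle n = n.choose 2 := by
  have h := two_mul_triangle n
  have h2 : (2 * (n.choose 2 : ℕ) : ℚ) = n * (n - 1) := by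
    rw [Nat.cast_choose_two]; ring
  have h3 : (2 * (n.choose 2 : ℕ) : ℤ) = n * (n - 1) := by exact_mod_cast h2
  linarith

lemma triangle_natCast_sub {n k : ℕ} (h : k ≤ n) : triangle (n - k) = (n - k).choose 2 := by
  rw [← Nat.cast_sub h, triangle_natCast]

/-! ### The symmetric basis and its multiplication rule -/

/-- `q^{C(k+1,2) - nk} [n,k]_q [n+k,k]_q`, a polynomial of degree `k` in `q^{-n} + q^{n+1}`. -/
noncomputable def symBasis (n k : ℕ) : LaurentPolynomial ℤ :=
  T (triangle (k + 1) - n * k) * qb n k * qb (n + k) k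

lemma symBasis_eq_zero_of_lt {n k : ℕ} (h : n < k) : symBasis n k = 0 := by
  simp [symBasis, qb_eq_zero_of_lt h]

/-- The node `q^{-n} + q^{n+1}`. -/
noncomputable def symNode (n : ℕ) : LaurentPolynomial ℤ := T (-n) + T (n + 1)

lemma symNode_sub (n j : ℕ) :
    symNode n - symNode j = T (-n) * (1 - T (n - j)) * (1 - T (n + j + 1)) := by
  have e1 : (T (-j) : LaurentPolynomial ℤ) = T (-n) * T (n - j) := by
    rw [← T_add]; congr 1; ring
  have e2 : (T (j + 1) : LaurentPolynomial ℤ) = T (-n) * T (n + j + 1) := by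
    rw [← T_add]; congr 1; ring
  have e3 : (T (n + 1) : LaurentPolynomial ℤ) = T (-n) * T (n - j) * T (n + j + 1) := by
    rw [← T_add, ← T_add]; congr 1; ring
  rw [symNode, symNode, e1, e2, e3]
  ring

lemma symBasis_succ (n j : ℕ) :
    (1 - T (j + 1)) ^ 2 * symBasis n (j + 1) =
      T (j + 1) * symBasis n j * (symNode n - symNode j) := by
  have h1 := one_sub_T_mul_qb_succ_right n j
  have h2 := one_sub_T_mul_qb_succ_right (n + j + 1) j
  have h3 := one_sub_T_mul_qb_succ_left (n + j) j
  push_cast at h2 h3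
  rw [show ((n : ℤ) + j + 1 - j) = n + 1 by ring] at h2 h3
  have e : (T (triangle ((j : ℤ) + 1 + 1) - n * (j + 1)) : LaurentPolynomial ℤ) =
      T (j + 1) * T (triangle (j + 1) - n * j) * T (-n) := by
    rw [← T_add, ← T_add]; congr 1
    linarith [two_mul_triangle ((j : ℤ) + 1 + 1), two_mul_triangle ((j : ℤ) + 1)]
  rw [symNode_sub, symBasis, symBasis, ← add_assoc]
  push_cast
  rw [e]
  linear_combination (T (j + 1) * T (triangle (j + 1) - n * j) * T (-n)) *
    ((1 - T (j + 1)) * qb (n + j + 1) (j + 1) * h1 + (1 - T (n - j)) * qb n j * (h2 - h3))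

/-- The structure constants of the multiplication of the functions `symBasis · k`. -/
noncomputable def linCoeff (k j i : ℕ) : LaurentPolynomial ℤ :=
  T (triangle (i - j) + triangle (i - k) - triangle i) * qb (k + j) i * qb i k * qb i j

lemma linCoeff_succ_zero (k j : ℕ) :
    (1 - T (j + 1)) ^ 2 * linCoeff k (j + 1) 0 =
      T (j + 1) * linCoeff k j 0 * (symNode 0 - symNode j) := by
  rw [linCoeff, qb_eq_zero_of_lt (show 0 < j + 1 by omega)]
  cases j with
  | zero => simp
  | succ j => simp [linCoeff, qb_eq_zero_of_lt (show 0 < j + 1 by omega)]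

lemma qb_three_term (k j i : ℕ) :
    (1 - T (j + 1)) * qb (k + j + 1) (i + 1) =
      (T (k + j - i) - T (j + 1)) * qb (k + j) i
        + (1 - T (i + j + 2)) * qb (k + j) (i + 1) := by
  have h := one_sub_T_mul_qb_succ_right (k + j) i
  have e : (T (i + j + 2) : LaurentPolynomial ℤ) = T (j + 1) * T (i + 1) := by
    rw [← T_add]; congr 1; ring
  push_cast at h
  rw [qb_succ_succ, e]
  linear_combination -h

lemma linCoeff_succ_succ (k j i : ℕ) :
    (1 - T (j + 1)) ^ 2 * linCoeff k (j + 1) (i + 1) =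
      T (j + 1) * (T (-(i + 1)) * (1 - T (i + 1)) ^ 2 * linCoeff k j i
        + linCoeff k j (i + 1) * (symNode (i + 1) - symNode j)) := by
  have h1 := one_sub_T_mul_qb_succ_right (i + 1) j
  have h2 := one_sub_T_mul_qb_succ_left i j
  have h3 := one_sub_T_mul_qb_succ_left i k
  have h4 := qb_three_term k j i
  push_cast at h1
  set E : LaurentPolynomial ℤ :=
    T (triangle (i + 1 - (j + 1)) + triangle (i + 1 - k) - triangle (i + 1)) with hE
  have e1 : (T (j + 1) * T (-(i + 1)) *
      T (triangle (i - j) + triangle (i - k) - triangle i) : LaurentPolynomial ℤ) =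
      E * T (k + j - i) := by
    rw [hE, ← T_add, ← T_add, ← T_add]; congr 1
    rw [show (i : ℤ) + 1 - (j + 1) = i - j by ring]
    linarith [two_mul_triangle ((i : ℤ) - k), two_mul_triangle (i : ℤ),
      two_mul_triangle ((i : ℤ) + 1 - k), two_mul_triangle ((i : ℤ) + 1)]
  have e2 : (T (j + 1) * T (-(i + 1)) *
      T (triangle (i + 1 - j) + triangle (i + 1 - k) - triangle (i + 1)) : LaurentPolynomial ℤ) =
      E := by
    rw [hE, ← T_add, ← T_add]; congr 1
    rw [show (i : ℤ) + 1 - (j + 1) = i - j by ring]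
    linarith [two_mul_triangle ((i : ℤ) - j), two_mul_triangle ((i : ℤ) + 1 - j)]
  have e3 : (T (j + 1) : LaurentPolynomial ℤ) = T (k + j - i) * T (i + 1 - k) := by
    rw [← T_add]; congr 1; ring
  have e4 : ((i : ℤ) + 1 + j + 1) = i + j + 2 := by ring
  rw [symNode_sub, linCoeff, linCoeff, linCoeff, ← add_assoc k j 1]
  push_cast
  rw [e4, ← hE]
  calc _ = E * (1 - T (j + 1)) * qb (k + j + 1) (i + 1) * qb (i + 1) k *
        ((1 - T (j + 1)) * qb (i + 1) (j + 1)) := by ring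
    _ = E * ((1 - T (j + 1)) * qb (k + j + 1) (i + 1)) * qb (i + 1) k *
        ((1 - T (i + 1 - j)) * qb (i + 1) j) := by rw [h1]; ring
    _ = (E * T (k + j - i)) * qb (k + j) i * ((1 - T (i + 1 - k)) * qb (i + 1) k) *
          ((1 - T (i + 1 - j)) * qb (i + 1) j) +
        E * (1 - T (i + j + 2)) * qb (k + j) (i + 1) * qb (i + 1) k *
          ((1 - T (i + 1 - j)) * qb (i + 1) j) := by rw [h4, e3]; ring
    _ = _ := by 
      rw [← h3, ← e1, ← e2]
      linear_combination (-(T (j + 1) * T (-(i + 1)) *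
        T (triangle (i - j) + triangle (i - k) - triangle i) * qb (k + j) i *
        (1 - T (i + 1)) * qb i k)) * h2

/-- A terminating `q`-Pfaff–Saalschütz summation, read as a linearization formula. -/
lemma symBasis_mul (n k j : ℕ) :
    symBasis n k * symBasis n j = ∑ i ∈ range (n + 1), linCoeff k j i * symBasis n i := by
  induction j with
  | zero =>
    rw [Finset.sum_eq_single k]
    · simp [symBasis, linCoeff, triangle]
    · intro i _ hi
      rcases lt_or_gt_of_ne hi with h | h
      · simp [linCoeff, qb_eq_zero_of_lt h]
      · simp [linCoeff, qb_eq_zero_of_lt h]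
    · intro hk
      rw [symBasis_eq_zero_of_lt (by rw [Finset.mem_range] at hk; omega), mul_zero]
  | succ j ih =>
    refine mul_left_cancel₀ (pow_ne_zero 2 (one_sub_T_ne_zero j)) ?_
    have hstep (i : ℕ) : T (j + 1) * (symNode n - symNode j) * (linCoeff k j i * symBasis n i) =
        T (j + 1) * (T (-(i + 1)) * (1 - T (i + 1)) ^ 2 * linCoeff k j i) * symBasis n (i + 1) +
        T (j + 1) * linCoeff k j i * (symNode i - symNode j) * symBasis n i := by
      have h := symBasis_succ n i
      have e : (T (-(i + 1)) * T (i + 1) : LaurentPolynomial ℤ) = 1 := by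
        rw [← T_add]; simp
      linear_combination - T (j + 1) * T (-(i + 1)) * linCoeff k j i * h -
        T (j + 1) * linCoeff k j i * symBasis n i * (symNode n - symNode i) * e
    calc _ = T (j + 1) * (symNode n - symNode j) * (symBasis n k * symBasis n j) := by
          linear_combination symBasis n k * symBasis_succ n j
      _ = _ := by
          rw [ih, Finset.mul_sum, Finset.sum_congr rfl fun i _ => hstep i,
            Finset.sum_add_distrib, Finset.sum_range_succ,
            symBasis_eq_zero_of_lt (Nat.lt_succ_self n), mul_zero, add_zero, Finset.sum_range_succ' _ n, Finset.mul_sum,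
            Finset.sum_range_succ' _ n, ← add_assoc, ← Finset.sum_add_distrib]
          congr 1
          · refine Finset.sum_congr rfl fun i _ => ?_
            linear_combination - symBasis n (i + 1) * linCoeff_succ_succ k j i
          · linear_combination - symBasis n 0 * linCoeff_succ_zero k j

/-! ### Powers of the symmetric basis -/

/-- The coefficients in
`symBasis n k ^ (s + 1) = ∑ i, q^{-s C(i,2)} * powCoeff s k i * symBasis n i`. -/
noncomputable def powCoeff : ℕ → ℕ → ℕ → Polynomial ℤ
  | 0, k, i => if i = k then 1 else 0
  | s + 1, k, i => ∑ j ∈ range (i + 1), powCoeff s k j *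
      (Polynomial.X ^ (s * (i.choose 2 - j.choose 2) + (i - j).choose 2 + (i - k).choose 2) *
        (qbinom (k + j) i * qbinom i k * qbinom i j))

lemma powCoeff_nonnegCoeffs (s k i : ℕ) : NonnegCoeffs (powCoeff s k i) := by
  induction s generalizing i with
  | zero =>
    rw [powCoeff]
    split_ifs
    exacts [.one, .zero]
  | succ s ih =>
    exact .sum fun j => (ih j).mul ((NonnegCoeffs.X_pow _).mul
      (((qbinom_nonnegCoeffs _ _).mul (qbinom_nonnegCoeffs _ _)).mul (qbinom_nonnegCoeffs _ _)))

lemma powCoeff_eq_zero_of_lt (s : ℕ) {k i : ℕ} (h : i < k) : powCoeff s k i = 0 := by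
  cases s with
  | zero => simp [powCoeff, h.ne]
  | succ s => simp [powCoeff, qbinom_eq_zero_of_lt h]

lemma toLaurent_powCoeff_succ (s k i n : ℕ) (hi : i ≤ n) :
    T (-((s + 1 : ℕ) * triangle i)) * (powCoeff (s + 1) k i).toLaurent =
      ∑ j ∈ range (n + 1),
        T (-(s * triangle j)) * (powCoeff s k j).toLaurent * linCoeff k j i := by
  rw [← Finset.sum_subset (Finset.range_mono (Nat.succ_le_succ hi)) (fun j _ hj => by
    rw [Finset.mem_range] at hj
    simp [linCoeff, qb_eq_zero_of_lt (show i < j by omega)]), powCoeff, map_sum, Finset.mul_sum]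
  refine Finset.sum_congr rfl fun j hj => ?_
  have hji : j ≤ i := by rw [Finset.mem_range] at hj; omega
  rcases lt_or_ge i k with h | hki
  · simp [linCoeff, qbinom_eq_zero_of_lt h, qb_eq_zero_of_lt h]
  simp only [map_mul, Polynomial.toLaurent_X_pow, linCoeff, ← qb.eq_1]
  have e : (T (-((s + 1 : ℕ) * triangle i)) * T ((s * (i.choose 2 - j.choose 2) +
      (i - j).choose 2 + (i - k).choose 2 : ℕ) : ℤ) : LaurentPolynomial ℤ) =
      T (-(s * triangle j)) * T (triangle (i - j) + triangle (i - k) - triangle i) := by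
    rw [← T_add, ← T_add, triangle_natCast_sub hji, triangle_natCast_sub hki]
    congr 1
    push_cast [Nat.cast_sub (Nat.choose_le_choose 2 hji), ← triangle_natCast]
    ring
  linear_combination ((powCoeff s k j).toLaurent * qb (k + j) i * qb i k * qb i j) * e

lemma symBasis_pow (n k s : ℕ) :
    symBasis n k ^ (s + 1) =
      ∑ i ∈ range (n + 1),
        T (-(s * triangle i)) * (powCoeff s k i).toLaurent * symBasis n i := by
  induction s with
  | zero =>
    rw [Finset.sum_eq_single k]
    · simp [powCoeff]
    · intro i _ hi
      simp [powCoeff, hi]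
    · intro hk
      rw [symBasis_eq_zero_of_lt (by rw [Finset.mem_range] at hk; omega)]
      simp
  | succ s ih =>
    rw [pow_succ, ih, Finset.sum_mul]
    calc _ = ∑ j ∈ range (n + 1), ∑ i ∈ range (n + 1),
          T (-(s * triangle j)) * (powCoeff s k j).toLaurent * linCoeff k j i * symBasis n i := by
          refine Finset.sum_congr rfl fun j _ => ?_
          rw [mul_assoc, mul_comm (symBasis n j), symBasis_mul n k j, Finset.mul_sum]
          simp only [mul_assoc]
      _ = _ := by
          rw [Finset.sum_comm]
          refine Finset.sum_congr rfl fun i hi => ?_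
          rw [toLaurent_powCoeff_succ s k i n (by simpa [Nat.lt_succ_iff] using hi),
            Finset.sum_mul]

lemma T_triangle_mul_symBasis {n k : ℕ} (h : k ≤ n) :
    T (triangle n) * symBasis n k = T ((n - k).choose 2) * qb n k * qb (n + k) k := by
  rw [symBasis, ← mul_assoc, ← mul_assoc, ← T_add, ← triangle_natCast_sub h]
  congr 3
  linarith [two_mul_triangle n, two_mul_triangle (k + 1), two_mul_triangle (n - k)]

/-- The expansion in the basis `q^{C(n-i,2)+(1-r)C(i,2)} [n,i]_q [n+i,i]_q` is unique. -/
lemma eq_of_qSchmidt_expansion_eq (r : ℤ) {c d : ℕ → Polynomial ℤ}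
    (h : ∀ n : ℕ,
      ∑ i ∈ range (n + 1), T (((n - i).choose 2 : ℤ) + (1 - r) * (i.choose 2)) *
        qb n i * qb (n + i) i * (c i).toLaurent =
      ∑ i ∈ range (n + 1), T (((n - i).choose 2 : ℤ) + (1 - r) * (i.choose 2)) *
        qb n i * qb (n + i) i * (d i).toLaurent) : c = d := by
  funext n
  induction n using Nat.strong_induction_on with
  | _ n ih =>
    have hn := h n
    rw [Finset.sum_range_succ, Finset.sum_range_succ, Finset.sum_congr rfl fun i hi => by
      rw [ih i (Finset.mem_range.mp hi)]] at hn
    refine Polynomial.toLaurent_injective (mul_left_cancel₀ ?_ (add_left_cancel hn))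
    exact mul_ne_zero (mul_ne_zero (isUnit_T _).ne_zero (qb_ne_zero le_rfl))
      (qb_ne_zero (Nat.le_add_left n n))

/-- **Theorem 1.1.** For every `r ≥ 1` there exists a unique sequence of polynomials
`c_i^{(r)}(q)` with nonnegative integer coefficients such that for all `n ≥ 0`:
`∑_{k=0}^n q^{r C(n-k,2)+(1-r) C(n,2)} [n,k]_q^r [n+k,k]_q^r
  = ∑_{i=0}^n q^{C(n-i,2)+(1-r) C(i,2)} [n,i]_q [n+i,i]_q c_i^{(r)}(q)`,
as an identity of Laurent polynomials in `q`. -/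
theorem zudilin_q_schmidt (r : ℕ) (hr : 1 ≤ r) :
    ∃! c : ℕ → Polynomial ℤ,
      (∀ i : ℕ, ∀ m : ℕ, 0 ≤ (c i).coeff m) ∧
      ∀ n : ℕ,
        ∑ k ∈ range (n + 1),
          T ((r : ℤ) * ((n - k).choose 2) + (1 - (r : ℤ)) * (n.choose 2)) *
            qb n k ^ r * qb (n + k) k ^ r
        = ∑ i ∈ range (n + 1),
          T (((n - i).choose 2 : ℤ) + (1 - (r : ℤ)) * (i.choose 2)) *
            qb n i * qb (n + i) i * (c i).toLaurent := by
  obtain ⟨s, rfl⟩ : ∃ s, r = s + 1 := ⟨r - 1, by omega⟩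
  refine existsUnique_of_exists_of_unique
    ⟨fun i => ∑ k ∈ range (i + 1), powCoeff s k i,
      fun i => NonnegCoeffs.sum fun k => powCoeff_nonnegCoeffs s k i, fun n => ?_⟩
    fun c d hc hd => eq_of_qSchmidt_expansion_eq _ fun n => (hc.2 n).symm.trans (hd.2 n)
  calc _ = ∑ k ∈ range (n + 1), T (triangle n) * symBasis n k ^ (s + 1) := by
        refine Finset.sum_congr rfl fun k hk => ?_
        have hk' : k ≤ n := by simpa [Nat.lt_succ_iff] using hk
        have e : (T (((s + 1 : ℕ) : ℤ) * ((n - k).choose 2) +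
            (1 - ((s + 1 : ℕ) : ℤ)) * (n.choose 2)) : LaurentPolynomial ℤ) =
            T ((n - k).choose 2) ^ (s + 1) * T (-(s * triangle n)) := by
          rw [T_pow, ← T_add, triangle_natCast]; congr 1; push_cast; ring
        have e' : (T (triangle n) ^ (s + 1) * T (-(s * triangle n)) : LaurentPolynomial ℤ) =
            T (triangle n) := by
          rw [T_pow, ← T_add]; congr 1; push_cast; ring
        calc _ = (T ((n - k).choose 2) * qb n k * qb (n + k) k) ^ (s + 1) *
              T (-(s * triangle n)) := by rw [e]; ring
          _ = (T (triangle n) ^ (s + 1) * T (-(s * triangle n))) * symBasis n k ^ (s + 1) := by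
              rw [← T_triangle_mul_symBasis hk']; ring
          _ = _ := by rw [e']
    _ = ∑ k ∈ range (n + 1), ∑ i ∈ range (n + 1), T (triangle n) *
          (T (-(s * triangle i)) * (powCoeff s k i).toLaurent * symBasis n i) := by
        simp only [symBasis_pow, Finset.mul_sum]
    _ = _ := by
        rw [Finset.sum_comm]
        refine Finset.sum_congr rfl fun i hi => ?_
        have hi' : i ≤ n := by simpa [Nat.lt_succ_iff] using hi
        rw [← Finset.sum_subset (Finset.range_mono (Nat.succ_le_succ hi')) (fun k _ hk => by
          rw [Finset.mem_range] at hk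
          simp [powCoeff_eq_zero_of_lt s (show i < k by omega)]), map_sum, Finset.mul_sum]
        refine Finset.sum_congr rfl fun k _ => ?_
        have e : (T (((n - i).choose 2 : ℤ) + (1 - ((s + 1 : ℕ) : ℤ)) * (i.choose 2)) :
            LaurentPolynomial ℤ) = T ((n - i).choose 2) * T (-(s * triangle i)) := by
          rw [← T_add, triangle_natCast]; congr 1; push_cast; ring
        rw [e]
        linear_combination T (-(s * triangle i)) * (powCoeff s k i).toLaurent *
          T_triangle_mul_symBasis hi'
end

section
/- Let f(x,y) and g(x,y) be any polynomials in two variables with integer coefficients, and for 0 ≤ k ≤ i set T_{k,i}^{(r)}(q) = q^{f(k,r)+g(i,r)} · P_{k,i}^{(r)}(q) (with P_{k,i}^{(r)}(q) = 0 if i > kr). Then for every integer r ≥ 1 and every integer n ≥ 0, ∑_{k=0}^n q^{−nkr+f(k,r)} · [n choose k]_q^r · [n+k choose k]_q^r = ∑_{i=0}^n q^{−ni−g(i,r)} · [n choose i]_q · [n+i choose i]_q · ∑_{k=0}^i T_{k,i}^{(r)}(q). -/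
open Polynomial LaurentPolynomial Finset

/-- The master identity (1.4): for any integer polynomials `f(x,y)`, `g(x,y)` and
`T_{k,i}^{(r)}(q) := q^{f(k,r)+g(i,r)} P_{k,i}^{(r)}(q)` (with `P_{k,i}^{(r)} = 0` for
`i > kr`), for every `r ≥ 1` and `n ≥ 0`:
`∑_{k=0}^n q^{-nkr+f(k,r)} [n,k]_q^r [n+k,k]_q^r
  = ∑_{i=0}^n q^{-ni-g(i,r)} [n,i]_q [n+i,i]_q ∑_{k=0}^i T_{k,i}^{(r)}(q)`.
Here `P r k i` denotes the Laurent polynomial `P_{k,i}^{(r)}(q)` of Lemma 1.2,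
characterized by the hypotheses. -/
theorem qSchmidt_master
    (f g : MvPolynomial (Fin 2) ℤ)
    (P : ℕ → ℕ → ℕ → LaurentPolynomial ℤ)
    (hPsupp : ∀ r k i : ℕ, i < k ∨ r * k < i → P r k i = 0)
    (hPnonneg : ∀ r k i : ℕ, ∀ m : ℤ, 0 ≤ (P r k i).coeff m)
    (hPid : ∀ r : ℕ, 1 ≤ r → ∀ k n : ℕ, k ≤ n →
      qb n k ^ r * qb (n + k) k ^ r
        = ∑ i ∈ Icc k (min n (r * k)),
            T (((r : ℤ) * k - i) * n) * qb n i * qb (n + i) i * P r k i)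
    (r : ℕ) (hr : 1 ≤ r) (n : ℕ) :
    ∑ k ∈ range (n + 1),
      T (-((n : ℤ) * k * r) + MvPolynomial.eval ![(k : ℤ), (r : ℤ)] f) *
        qb n k ^ r * qb (n + k) k ^ r
    = ∑ i ∈ range (n + 1),
      T (-((n : ℤ) * i) - MvPolynomial.eval ![(i : ℤ), (r : ℤ)] g) *
        qb n i * qb (n + i) i *
        ∑ k ∈ range (i + 1),
          T (MvPolynomial.eval ![(k : ℤ), (r : ℤ)] f +
              MvPolynomial.eval ![(i : ℤ), (r : ℤ)] g) * P r k i := by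
  have expand : ∀ k ∈ range (n + 1),
      qb n k ^ r * qb (n + k) k ^ r
        = ∑ i ∈ range (n + 1),
            T (((r : ℤ) * k - i) * n) * qb n i * qb (n + i) i * P r k i := by
    intro k hk
    rw [hPid r hr k n (by simpa [Nat.lt_succ_iff] using hk)]
    refine sum_subset (fun i hi => ?_) (fun i hi hi' => ?_)
    · simp only [mem_Icc, mem_range] at hi ⊢
      omega
    · simp only [mem_Icc, mem_range] at hi hi'
      rw [hPsupp r k i (by omega), mul_zero]
  have extend : ∀ i ∈ range (n + 1),
      ∑ k ∈ range (i + 1),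
          T (MvPolynomial.eval ![(k : ℤ), (r : ℤ)] f +
              MvPolynomial.eval ![(i : ℤ), (r : ℤ)] g) * P r k i
        = ∑ k ∈ range (n + 1),
          T (MvPolynomial.eval ![(k : ℤ), (r : ℤ)] f +
              MvPolynomial.eval ![(i : ℤ), (r : ℤ)] g) * P r k i := by
    intro i hi
    refine sum_subset (fun k hk => ?_) (fun k hk hk' => ?_)
    · simp only [mem_range] at hi hk ⊢
      omega
    · simp only [mem_range] at hk'
      rw [hPsupp r k i (by omega), mul_zero]
  rw [sum_congr rfl fun k hk => by rw [mul_assoc, expand k hk, mul_sum], sum_comm]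
  refine sum_congr rfl fun i hi => ?_
  rw [extend i hi, mul_sum]
  refine sum_congr rfl fun k _ => ?_
  generalize MvPolynomial.eval ![(k : ℤ), (r : ℤ)] f = a
  generalize MvPolynomial.eval ![(i : ℤ), (r : ℤ)] g = b
  have hT : (T (-((n : ℤ) * k * r) + a) * T (((r : ℤ) * k - i) * n) : LaurentPolynomial ℤ)
      = T (-((n : ℤ) * i) - b) * T (a + b) := by
    rw [← T_add, ← T_add]
    congr 1
    ring
  linear_combination (qb n i * qb (n + i) i * P r k i) * hT
end

section
/- For all integers 0 ≤ k ≤ n and 0 ≤ i ≤ n, one has [n choose i]_q · [n+i choose i]_q = ∑_{j=0}^{i} q^{(i−j)(n−k−j)} · ((q)_{k+i} (q)_j / ((q)_{k+j} (q)_i)) · [k choose i−j]_q · [n−k choose j]_q · [n+k+j choose j]_q, as an identity in the field of rational functions ℚ(q). -/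
open Finset

/-- The q-Pochhammer symbol `(q)_n = (1-q)(1-q²)⋯(1-qⁿ)` in the field of rational
functions `ℚ(q)` (with `q = RatFunc.X`). -/
noncomputable def qfac (n : ℕ) : RatFunc ℚ := ∏ i ∈ range n, (1 - RatFunc.X ^ (i + 1))

/-- The q-binomial coefficient `[n choose k]_q = (q)_n / ((q)_k (q)_{n-k})` in `ℚ(q)`,
vanishing for `k > n`. -/
noncomputable def qbF (n k : ℕ) : RatFunc ℚ :=
  if k ≤ n then qfac n / (qfac k * qfac (n - k)) else 0

local notation "q" => (RatFunc.X : RatFunc ℚ)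

lemma one_sub_X_pow_succ_ne_zero (m : ℕ) : (1 - q ^ (m + 1)) ≠ 0 := by
  have h : (1 - Polynomial.X ^ (m + 1) : Polynomial ℚ) ≠ 0 := by
    intro h
    simpa using congrArg (Polynomial.eval 0) h
  have h' := (map_ne_zero_iff (algebraMap (Polynomial ℚ) (RatFunc ℚ))
    (RatFunc.algebraMap_injective ℚ)).2 h
  simpa using h'

lemma qfac_zero : qfac 0 = 1 := by simp [qfac]

lemma qfac_succ (m : ℕ) : qfac (m + 1) = qfac m * (1 - q ^ (m + 1)) :=
  prod_range_succ _ _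

lemma qfac_ne_zero (m : ℕ) : qfac m ≠ 0 :=
  prod_ne_zero_iff.2 fun _ _ => one_sub_X_pow_succ_ne_zero _

lemma qbF_zero_right (m : ℕ) : qbF m 0 = 1 := by
  simp [qbF, qfac_zero, qfac_ne_zero]

lemma qbF_succ_right (m d : ℕ) :
    qbF m (d + 1) * (1 - q ^ (d + 1)) = qbF m d * (1 - q ^ ((m : ℤ) - d)) := by
  rcases lt_trichotomy d m with h | rfl | h
  · obtain ⟨e, rfl⟩ := Nat.exists_eq_add_of_lt h
    have e1 : d + e + 1 - (d + 1) = e := by omega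
    have e2 : d + e + 1 - d = e + 1 := by omega
    have e3 : ((d + e + 1 : ℕ) : ℤ) - d = ((e + 1 : ℕ) : ℤ) := by push_cast; ring
    rw [qbF, qbF, if_pos (by omega), if_pos (by omega), e1, e2, e3, zpow_natCast,
      qfac_succ d, qfac_succ e]
    have := qfac_ne_zero d
    have := qfac_ne_zero e
    have := one_sub_X_pow_succ_ne_zero d
    have := one_sub_X_pow_succ_ne_zero e
    field_simp
  · simp [qbF]
  · rw [qbF, qbF, if_neg (by omega), if_neg (by omega)]
    ring

lemma qbF_mul_qfac (m j : ℕ) :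
    qbF m j * qfac j = ∏ l ∈ range j, (1 - q ^ ((m : ℤ) - l)) := by
  induction j with
  | zero => simp [qbF_zero_right, qfac_zero]
  | succ j ih =>
    rw [prod_range_succ, ← ih, qfac_succ]
    linear_combination qfac j * qbF_succ_right m j

lemma qfac_add (m j : ℕ) :
    qfac (m + j) = qfac m * ∏ l ∈ range j, (1 - q ^ (m + l + 1)) := by
  induction j with
  | zero => simp
  | succ j ih => rw [prod_range_succ, ← mul_assoc, ← ih, ← add_assoc, qfac_succ]

lemma qbF_add_mul_qfac (m j : ℕ) :
    qbF (m + j) j * qfac j = ∏ l ∈ range j, (1 - q ^ (m + l + 1)) := by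
  rw [qbF, if_pos (by omega), Nat.add_sub_cancel, qfac_add]
  have := qfac_ne_zero j
  have := qfac_ne_zero m
  field_simp

/-- The quadratic factor `(1 - q^(n+k+l+1)) (1 - q^(n-k-l))`. -/
noncomputable def pairFactor (n k l : ℕ) : RatFunc ℚ :=
  (1 - q ^ (n + k + l + 1)) * (1 - q ^ ((n : ℤ) - k - l))

/-- The coefficient of `∏ l < j, pairFactor n k l` in the expansion of
`∏ l < j + d, pairFactor n 0 l`. -/
noncomputable def expansionCoeff (n k j d : ℕ) : RatFunc ℚ :=
  (q ^ ((n : ℤ) - k - j)) ^ d *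
    (qfac (k + j + d) * qfac (j + d) / (qfac (k + j) * qfac j)) * qbF k d

lemma expansionCoeff_zero_right (n k j : ℕ) : expansionCoeff n k j 0 = 1 := by
  have := qfac_ne_zero (k + j)
  have := qfac_ne_zero j
  simp [expansionCoeff, qbF_zero_right, *]

lemma pairFactor_sub (n k j d : ℕ) :
    pairFactor n 0 (j + d) - pairFactor n k j =
      q ^ ((n : ℤ) - k - j) * (1 - q ^ ((k : ℤ) - d)) * (1 - q ^ (k + j + j + d + 1)) := by
  have hq : q ≠ 0 := RatFunc.X_ne_zero
  simp only [pairFactor, zpow_sub₀ hq, zpow_natCast, pow_add, Nat.cast_add, zpow_add₀ hq,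
    Nat.cast_zero, zpow_zero, pow_zero, pow_one]
  field_simp
  ring

lemma expansionCoeff_zero_succ (n k d : ℕ) :
    expansionCoeff n k 0 (d + 1) =
      (pairFactor n 0 (0 + d) - pairFactor n k 0) * expansionCoeff n k 0 d := by
  have h := qbF_succ_right k d
  have hd := one_sub_X_pow_succ_ne_zero d
  have hk := qfac_ne_zero k
  rw [← eq_div_iff hd] at h
  rw [pairFactor_sub, expansionCoeff, expansionCoeff, h]
  simp only [zero_add, add_zero, ← add_assoc, qfac_succ, qfac_zero]
  generalize q ^ ((n : ℤ) - k - (0 : ℕ)) = z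
  field_simp
  ring

lemma expansionCoeff_succ_succ (n k j d : ℕ) :
    expansionCoeff n k (j + 1) (d + 1) = expansionCoeff n k j (d + 1) +
      (pairFactor n 0 (j + 1 + d) - pairFactor n k (j + 1)) * expansionCoeff n k (j + 1) d := by
  have hq : q ≠ 0 := RatFunc.X_ne_zero
  have h := qbF_succ_right k d
  have hd := one_sub_X_pow_succ_ne_zero d
  have hj := one_sub_X_pow_succ_ne_zero j
  have hkj := one_sub_X_pow_succ_ne_zero (k + j)
  have := qfac_ne_zero (k + j)
  have := qfac_ne_zero j
  have hshift : q ^ ((n : ℤ) - k - j) = q ^ ((n : ℤ) - k - (j + 1 : ℕ)) * q := by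
    rw [← zpow_add_one₀ hq]
    congr 1
    push_cast
    ring
  rw [pairFactor_sub, expansionCoeff, expansionCoeff, expansionCoeff, hshift]
  have e1 : k + (j + 1) + (d + 1) = (k + j + d + 1) + 1 := by ring
  have e2 : j + 1 + (d + 1) = (j + d + 1) + 1 := by ring
  have e3 : k + j + (d + 1) = k + j + d + 1 := by ring
  have e4 : j + (d + 1) = j + d + 1 := by ring
  have e5 : k + (j + 1) + d = k + j + d + 1 := by ring
  have e6 : j + 1 + d = j + d + 1 := by ring
  have e7 : k + (j + 1) = k + j + 1 := by ring
  rw [e1, e2, e3, e4, e5, e6, e7, qfac_succ (k + j + d + 1), qfac_succ (j + d + 1),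
    qfac_succ (k + j), qfac_succ j]
  generalize q ^ ((n : ℤ) - k - (j + 1 : ℕ)) = z
  rw [mul_pow z q]
  generalize qfac (k + j + d + 1) = F
  generalize qfac (j + d + 1) = G
  have key : (1 - q ^ (k + j + d + 1 + 1)) * (1 - q ^ (j + d + 1 + 1)) =
      q ^ (d + 1) * ((1 - q ^ (k + j + 1)) * (1 - q ^ (j + 1))) +
        (1 - q ^ (d + 1)) * (1 - q ^ (k + j + 1 + (j + 1) + d + 1)) := by ring
  field_simp
  linear_combination z ^ (d + 1) * F * G * qbF k (d + 1) * key +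
    z ^ (d + 1) * F * G * (1 - q ^ (k + j + 1 + (j + 1) + d + 1)) * h

/-- Newton expansion of `∏ l < i, pairFactor n 0 l` in the products of `pairFactor n k`. -/
lemma prod_pairFactor_eq_sum (n k i : ℕ) :
    ∏ l ∈ range i, pairFactor n 0 l =
      ∑ j ∈ range (i + 1), expansionCoeff n k j (i - j) * ∏ l ∈ range j, pairFactor n k l := by
  induction i with
  | zero => simp [expansionCoeff_zero_right]
  | succ i ih =>
    set Q : ℕ → RatFunc ℚ := fun j => ∏ l ∈ range j, pairFactor n k l with hQ
    have hQs (j : ℕ) : Q (j + 1) = Q j * pairFactor n k j := prod_range_succ _ _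
    have split : ∀ j ∈ range (i + 1), expansionCoeff n k j (i - j) * Q j * pairFactor n 0 i =
        expansionCoeff n k j (i - j) * Q (j + 1) +
          (pairFactor n 0 i - pairFactor n k j) * expansionCoeff n k j (i - j) * Q j := by
      intro j _
      rw [hQs]
      ring
    rw [prod_range_succ, ih, sum_mul, sum_congr rfl split, sum_add_distrib,
      sum_range_succ (fun j => expansionCoeff n k j (i - j) * Q (j + 1)),
      sum_range_succ' (fun j => (pairFactor n 0 i - pairFactor n k j) *
        expansionCoeff n k j (i - j) * Q j),
      sum_range_succ, sum_range_succ']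
    have mid : ∀ j ∈ range i, expansionCoeff n k (j + 1) (i + 1 - (j + 1)) * Q (j + 1) =
        expansionCoeff n k j (i - j) * Q (j + 1) +
          (pairFactor n 0 i - pairFactor n k (j + 1)) *
            expansionCoeff n k (j + 1) (i - (j + 1)) * Q (j + 1) := by
      intro j hj
      obtain ⟨d, rfl⟩ := Nat.exists_eq_add_of_lt (mem_range.1 hj)
      have e1 : j + d + 1 + 1 - (j + 1) = d + 1 := by omega
      have e2 : j + d + 1 - j = d + 1 := by omega
      have e3 : j + d + 1 - (j + 1) = d := by omega
      have e4 : j + d + 1 = j + 1 + d := by omega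
      rw [e1, e2, e3, e4, expansionCoeff_succ_succ]
      ring
    have first := expansionCoeff_zero_succ n k i
    rw [zero_add] at first
    rw [sum_congr rfl mid, sum_add_distrib]
    simp only [Nat.sub_self, Nat.sub_zero, expansionCoeff_zero_right, first]
    ring

lemma qbF_mul_qbF_add_mul_qfac_sq (m N j : ℕ) :
    qbF m j * qbF (N + j) j * qfac j ^ 2 =
      ∏ l ∈ range j, (1 - q ^ (N + l + 1)) * (1 - q ^ ((m : ℤ) - l)) := by
  rw [prod_mul_distrib, ← qbF_mul_qfac, ← qbF_add_mul_qfac]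
  ring

/-- Identity (2.2): for `0 ≤ k ≤ n` and `0 ≤ i ≤ n`, in `ℚ(q)`:
`[n,i]_q [n+i,i]_q = ∑_{j=0}^i q^{(i-j)(n-k-j)} ((q)_{k+i}(q)_j / ((q)_{k+j}(q)_i))
  [k,i-j]_q [n-k,j]_q [n+k+j,j]_q`. -/
theorem q_lemma_ratfunc (n k i : ℕ) (hk : k ≤ n) (hi : i ≤ n) :
    qbF n i * qbF (n + i) i
      = ∑ j ∈ range (i + 1),
          (RatFunc.X : RatFunc ℚ) ^ ((((i : ℤ) - j) * ((n : ℤ) - k - j))) *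
            (qfac (k + i) * qfac j / (qfac (k + j) * qfac i)) *
            qbF k (i - j) * qbF (n - k) j * qbF (n + k + j) j := by
  have hi' := qfac_ne_zero i
  rw [← mul_left_inj' (pow_ne_zero 2 hi'), qbF_mul_qbF_add_mul_qfac_sq, sum_mul]
  have hprod := prod_pairFactor_eq_sum n k i
  simp only [pairFactor, add_zero, Nat.cast_zero, sub_zero] at hprod
  rw [hprod]
  refine sum_congr rfl fun j hj => ?_
  obtain ⟨d, rfl⟩ := Nat.exists_eq_add_of_le (Nat.le_of_lt_succ (mem_range.1 hj))
  have hQ := qbF_mul_qbF_add_mul_qfac_sq (n - k) (n + k) j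
  rw [Nat.cast_sub hk] at hQ
  have hexp : (((j + d : ℕ) : ℤ) - j) * ((n : ℤ) - k - j) = ((n : ℤ) - k - j) * (d : ℕ) := by
    push_cast
    ring
  have := qfac_ne_zero j
  have := qfac_ne_zero (k + j)
  rw [← hQ, hexp, zpow_mul, zpow_natCast, expansionCoeff, Nat.add_sub_cancel_left, ← add_assoc]
  field_simp
end

section
/- For all positive integers r and s, there exists a unique sequence of rational numbers (c_k^{(r,s)})_{k ≥ 0}, independent of n, such that for every integer n ≥ 0 one has ∑_{k=0}^n C(n,k)^r · C(n+k,k)^r = ∑_{k=0}^n C(n,k)^s · C(n+k,k)^s · c_k^{(r,s)}, where C(a,b) denotes the ordinary binomial coefficient. -/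
open Finset

/-- A lower triangular system of linear equations over a field, indexed by `ℕ`, with nonzero
diagonal entries has exactly one solution. -/
theorem existsUnique_lowerTriangular_solution {K : Type*} [Field K] (a : ℕ → ℕ → K) (b : ℕ → K)
    (ha : ∀ n, a n n ≠ 0) :
    ∃! c : ℕ → K, ∀ n, b n = ∑ k ∈ range (n + 1), a n k * c k := by
  let solve : (n : ℕ) → ((m : ℕ) → m < n → K) → K := fun n prev =>
    (b n - ∑ k : Fin n, a n k * prev k k.isLt) / a n n
  have solve_eq (n : ℕ) : WellFoundedLT.fix solve n
      = (b n - ∑ k ∈ range n, a n k * WellFoundedLT.fix solve k) / a n n := by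
    rw [WellFoundedLT.fix_eq]
    simp only [solve]
    rw [Fin.sum_univ_eq_sum_range (fun k => a n k * WellFoundedLT.fix solve k)]
  refine ⟨WellFoundedLT.fix solve, fun n => ?_, fun d hd => funext fun n => ?_⟩
  · rw [sum_range_succ, solve_eq n, mul_div_cancel₀ _ (ha n)]
    ring
  · induction n using Nat.strong_induction_on with
    | _ n ih =>
      have hsum : ∑ k ∈ range n, a n k * d k
          = ∑ k ∈ range n, a n k * WellFoundedLT.fix solve k :=
        sum_congr rfl fun k hk => by rw [ih k (mem_range.mp hk)]
      rw [solve_eq n, eq_div_iff (ha n), hd n, sum_range_succ, hsum]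
      ring

/-- Identity (4.1): for all positive integers `r` and `s`, there is a unique sequence of
rational numbers `c_k^{(r,s)}`, independent of `n`, such that for every `n ≥ 0`:
`∑_{k=0}^n C(n,k)^r C(n+k,k)^r = ∑_{k=0}^n C(n,k)^s C(n+k,k)^s c_k^{(r,s)}`. -/
theorem schmidt_rational_coeffs (r s : ℕ) (hr : 1 ≤ r) (hs : 1 ≤ s) :
    ∃! c : ℕ → ℚ,
      ∀ n : ℕ,
        ∑ k ∈ range (n + 1), ((n.choose k : ℚ) ^ r * ((n + k).choose k : ℚ) ^ r)
        = ∑ k ∈ range (n + 1),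
            (n.choose k : ℚ) ^ s * ((n + k).choose k : ℚ) ^ s * c k := by
  refine existsUnique_lowerTriangular_solution
    (fun n k => (n.choose k : ℚ) ^ s * ((n + k).choose k : ℚ) ^ s) _ fun n => ?_
  have hpos : 0 < (n + n).choose n := Nat.choose_pos (Nat.le_add_left n n)
  simp only [Nat.choose_self, Nat.cast_one, one_pow, one_mul]
  positivity
end

section
/- (Schmidt's problem, q = 1 specialization of Theorem 1.1) For every integer r ≥ 1 there exists a sequence of nonnegative integers (c_i^{(r)})_{i=0}^∞ such that for every integer n ≥ 0, ∑_{k=0}^n C(n,k)^r · C(n+k,k)^r = ∑_{i=0}^n C(n,i) · C(n+i,i) · c_i^{(r)}, where C(a,b) denotes the ordinary binomial coefficient. -/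
open Finset

/-- The product `C(n,k) C(n+k,k)`, which vanishes for `k > n`. -/
def schmidtTerm (n k : ℕ) : ℕ := n.choose k * (n + k).choose k

/-- The coefficient of `schmidtTerm n (k + m)` in `schmidtTerm n k * schmidtTerm n i`. -/
def schmidtCoeff (k i m : ℕ) : ℕ := (k + i).choose i * (k + m).choose i * i.choose m

lemma schmidtTerm_eq_zero {n k : ℕ} (h : n < k) : schmidtTerm n k = 0 := by
  simp [schmidtTerm, Nat.choose_eq_zero_of_lt h]

lemma cast_choose_succ_right (n k : ℕ) :
    (n.choose (k + 1) : ℤ) * (k + 1) = n.choose k * (n - k) := by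
  rcases le_or_gt k n with h | h
  · have := Nat.choose_succ_right_eq n k
    zify [h] at this
    exact this
  · simp [Nat.choose_eq_zero_of_lt h, Nat.choose_eq_zero_of_lt (Nat.lt_succ_of_lt h)]

lemma cast_choose_succ_succ_mul (n k : ℕ) :
    ((n + 1).choose (k + 1) : ℤ) * (k + 1) = (n + 1) * n.choose k := by
  exact_mod_cast (Nat.add_one_mul_choose_eq n k).symm

lemma cast_choose_succ_left_mul (n k : ℕ) :
    ((n + 1).choose k : ℤ) * (n + 1 - k) = (n + 1) * n.choose k := by
  have h := cast_choose_succ_right (n + 1) k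
  rw [cast_choose_succ_succ_mul] at h
  push_cast at h
  exact h.symm

lemma schmidtTerm_succ (n k : ℕ) :
    ((k : ℤ) + 1) ^ 2 * schmidtTerm n (k + 1) = (n * (n + 1) - k * (k + 1)) * schmidtTerm n k := by
  have h₁ := cast_choose_succ_right n k
  have h₂ := cast_choose_succ_succ_mul (n + k) k
  rw [schmidtTerm, schmidtTerm, ← add_assoc]
  push_cast at h₂ ⊢
  linear_combination ((n + k + 1).choose (k + 1) : ℤ) * (k + 1) * h₁
    + (n.choose k : ℤ) * (n - k) * h₂

lemma schmidtCoeff_succ_zero (k i : ℕ) :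
    ((i : ℤ) + 1) ^ 2 * schmidtCoeff k (i + 1) 0 =
      (k * (k + 1) - i * (i + 1)) * schmidtCoeff k i 0 := by
  have h₁ := cast_choose_succ_right k i
  have h₂ := cast_choose_succ_succ_mul (k + i) i
  simp only [schmidtCoeff, Nat.choose_zero_right, add_zero, mul_one, ← add_assoc]
  push_cast at h₂ ⊢
  linear_combination ((k + i + 1).choose (i + 1) : ℤ) * (i + 1) * h₁
    + (k.choose i : ℤ) * (k - i) * h₂

lemma schmidtCoeff_succ_succ (k i m : ℕ) :
    ((i : ℤ) + 1) ^ 2 * schmidtCoeff k (i + 1) (m + 1) =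
      (k + m + 1) ^ 2 * schmidtCoeff k i m +
        ((k + m + 1) * (k + m + 2) - i * (i + 1)) * schmidtCoeff k i (m + 1) := by
  have h₁ := cast_choose_succ_succ_mul (k + i) i
  have h₂ := cast_choose_succ_succ_mul (k + m) i
  have h₃ := cast_choose_succ_left_mul (k + m) i
  have h₄ := cast_choose_succ_right i m
  simp only [schmidtCoeff, ← add_assoc, Nat.choose_succ_succ i m]
  push_cast at h₁ h₂ h₃ ⊢
  linear_combination ((i.choose m : ℤ) + i.choose (m + 1)) *
      (((k + m + 1).choose (i + 1) : ℤ) * (i + 1) * h₁ + (k + i + 1) * (k + i).choose i * h₂)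
    - (k + m + 2 + i) * (k + i).choose i * (i.choose (m + 1) : ℤ) * h₃
    - (k + i).choose i * (k + m + 1) * ((k + m).choose i : ℤ) * h₄

lemma schmidtTerm_mul (n k i : ℕ) :
    (schmidtTerm n k * schmidtTerm n i : ℤ) =
      ∑ m ∈ range (i + 1), (schmidtTerm n (k + m) * schmidtCoeff k i m : ℤ) := by
  induction i with
  | zero => simp [schmidtTerm, schmidtCoeff]
  | succ i ih =>
    have hi : ((i : ℤ) + 1) ^ 2 ≠ 0 := by positivity
    apply mul_left_cancel₀ hi
    have htop : schmidtCoeff k i (i + 1) = 0 := by simp [schmidtCoeff]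
    calc ((i : ℤ) + 1) ^ 2 * (schmidtTerm n k * schmidtTerm n (i + 1))
        = (n * (n + 1) - i * (i + 1)) * (schmidtTerm n k * schmidtTerm n i) := by
          linear_combination (schmidtTerm n k : ℤ) * schmidtTerm_succ n i
      _ = ∑ m ∈ range (i + 1),
            ((k + m + 1) ^ 2 * schmidtTerm n (k + m + 1) * schmidtCoeff k i m : ℤ) +
          ∑ m ∈ range (i + 1), (((k + m) * (k + m + 1) - i * (i + 1)) *
            schmidtTerm n (k + m) * schmidtCoeff k i m : ℤ) := by
          rw [ih, mul_sum, ← sum_add_distrib]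
          refine sum_congr rfl fun m _ => ?_
          have h := schmidtTerm_succ n (k + m)
          push_cast at h
          linear_combination -(schmidtCoeff k i m : ℤ) * h
      _ = ∑ m ∈ range (i + 1),
            ((k + m + 1) ^ 2 * schmidtTerm n (k + m + 1) * schmidtCoeff k i m : ℤ) +
          ∑ m ∈ range (i + 1 + 1), (((k + m) * (k + m + 1) - i * (i + 1)) *
            schmidtTerm n (k + m) * schmidtCoeff k i m : ℤ) := by
          rw [sum_range_succ _ (i + 1), htop]
          simp
      _ = _ := by
          rw [mul_sum, sum_range_succ' _ (i + 1), sum_range_succ' _ (i + 1), ← add_assoc,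
            ← sum_add_distrib]
          congr 1
          · refine sum_congr rfl fun m _ => ?_
            have h := schmidtCoeff_succ_succ k i m
            rw [← add_assoc]
            push_cast
            linear_combination -(schmidtTerm n (k + m + 1) : ℤ) * h
          · have h := schmidtCoeff_succ_zero k i
            simp only [add_zero, Nat.cast_zero]
            linear_combination -(schmidtTerm n k : ℤ) * h

lemma exists_schmidtTerm_mul (k i : ℕ) :
    ∃ a : ℕ → ℕ, (∀ j < k, a j = 0) ∧ ∀ n,
      schmidtTerm n k * schmidtTerm n i = ∑ j ∈ range (n + 1), schmidtTerm n j * a j := by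
  refine ⟨fun j => if k ≤ j then schmidtCoeff k i (j - k) else 0,
    fun j hj => if_neg hj.not_ge, fun n => ?_⟩
  have h : schmidtTerm n k * schmidtTerm n i =
      ∑ m ∈ range (i + 1), schmidtTerm n (k + m) * schmidtCoeff k i m := by
    exact_mod_cast schmidtTerm_mul n k i
  have hext : ∑ m ∈ range (i + 1), schmidtTerm n (k + m) * schmidtCoeff k i m =
      ∑ m ∈ range (i + 1 + n), schmidtTerm n (k + m) * schmidtCoeff k i m := by
    refine sum_subset (range_mono (by lia)) fun m _ hm => ?_
    rw [mem_range, not_lt] at hm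
    simp [schmidtCoeff, Nat.choose_eq_zero_of_lt hm]
  have htrunc : ∀ a : ℕ → ℕ, ∑ j ∈ range (n + 1), schmidtTerm n j * a j =
      ∑ j ∈ range (k + (i + 1 + n)), schmidtTerm n j * a j := fun a => by
    refine sum_subset (range_mono (by lia)) fun j _ hj => ?_
    rw [mem_range, not_lt] at hj
    simp [schmidtTerm_eq_zero hj]
  rw [h, hext, htrunc, sum_range_add _ k, sum_eq_zero (s := range k), zero_add]
  · simp
  · intro j hj
    simp [(mem_range.mp hj).not_ge]

lemma exists_schmidtTerm_pow (k r : ℕ) :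
    ∃ b : ℕ → ℕ, (∀ j < k, b j = 0) ∧ ∀ n,
      schmidtTerm n k ^ (r + 1) = ∑ j ∈ range (n + 1), schmidtTerm n j * b j := by
  induction r with
  | zero =>
    refine ⟨fun j => if j = k then 1 else 0, fun j hj => if_neg hj.ne, fun n => ?_⟩
    rcases le_or_gt k n with h | h
    · simp [Nat.lt_succ_of_le h]
    · simp [schmidtTerm_eq_zero h]
  | succ r ih =>
    obtain ⟨b, hb, hpow⟩ := ih
    choose a ha hmul using fun i => exists_schmidtTerm_mul i k
    refine ⟨fun l => ∑ j ∈ range (l + 1), b j * a j l, fun l hl => ?_, fun n => ?_⟩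
    · refine sum_eq_zero fun j hj => ?_
      rw [hb j (by rw [mem_range] at hj; lia), zero_mul]
    · have hext : ∀ l ∈ range (n + 1), ∑ j ∈ range (l + 1), b j * a j l =
          ∑ j ∈ range (n + 1), b j * a j l := fun l hl => by
        refine sum_subset (range_mono (by rw [mem_range] at hl; lia)) fun j _ hj => ?_
        rw [ha j l (by rw [mem_range] at hj; lia), mul_zero]
      calc schmidtTerm n k ^ (r + 1 + 1)
          = ∑ j ∈ range (n + 1), ∑ l ∈ range (n + 1), schmidtTerm n l * (b j * a j l) := by
            rw [pow_succ, hpow, sum_mul]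
            refine sum_congr rfl fun j _ => ?_
            rw [mul_right_comm, hmul, sum_mul]
            exact sum_congr rfl fun l _ => by ring
        _ = _ := by
            rw [sum_comm]
            exact sum_congr rfl fun l hl => by simp only [hext l hl, mul_sum]

/-- **Schmidt's problem** (the `q = 1` specialization of Theorem 1.1): for every `r ≥ 1`
there is a sequence of nonnegative integers `c_i^{(r)}` such that for every `n ≥ 0`:
`∑_{k=0}^n C(n,k)^r C(n+k,k)^r = ∑_{i=0}^n C(n,i) C(n+i,i) c_i^{(r)}`. -/
theorem schmidt_problem (r : ℕ) (hr : 1 ≤ r) :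
    ∃ c : ℕ → ℕ,
      ∀ n : ℕ,
        ∑ k ∈ range (n + 1), n.choose k ^ r * (n + k).choose k ^ r
        = ∑ i ∈ range (n + 1), n.choose i * (n + i).choose i * c i := by
  obtain ⟨r, rfl⟩ := Nat.exists_eq_add_of_le' hr
  choose b hb hpow using fun k => exists_schmidtTerm_pow k r
  refine ⟨fun i => ∑ k ∈ range (i + 1), b k i, fun n => ?_⟩
  have hext : ∀ i ∈ range (n + 1), ∑ k ∈ range (i + 1), b k i =
      ∑ k ∈ range (n + 1), b k i := fun i hi => by
    refine sum_subset (range_mono (by rw [mem_range] at hi; lia)) fun k _ hk => ?_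
    exact hb k i (by rw [mem_range] at hk; lia)
  simp only [← mul_pow]
  change ∑ k ∈ range (n + 1), schmidtTerm n k ^ (r + 1) =
    ∑ i ∈ range (n + 1), schmidtTerm n i * ∑ k ∈ range (i + 1), b k i
  rw [sum_congr rfl fun k _ => hpow k n, sum_comm]
  exact sum_congr rfl fun i hi => by rw [hext i hi, mul_sum]
end
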